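/- arXiv:1010.3680 — 6 statements merged into one kernel-verified Lean document; each statement's English description precedes it below -/
import Mathlib

section
/- For every real number x that is not an integer, the series 1/x + ∑_{n=1}^∞ (1/(x−n) + 1/(x+n)) converges and its sum equals π·cot(πx). -/
open Real

theorem cotangent_series_expansion (x : ℝ) (hx : ∀ n : ℤ, x ≠ n) :
    HasSum (fun n : ℕ => 1 / (x - (n + 1)) + 1 / (x + (n + 1)))
      (Real.pi * Real.cot (Real.pi * x) - 1 / x) := by
  have hz : (x : ℂ) ∈ Complex.integerComplement := by
    rintro ⟨n, hn⟩
    exact hx n (by exact_mod_cast hn.symm)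
  have h := (summable_cotTerm hz).hasSum_iff_tendsto_nat.mpr (tendsto_logDeriv_euler_cot_sub hz)
  rw [← Complex.hasSum_ofReal]
  push_cast
  exact h
end

section
/- For every real number x that is not an integer, the family (1/(x−n)²)_{n∈ℤ} is summable and ∑_{n∈ℤ} 1/(x−n)² = π²/sin²(πx). -/
open Real

/-- The Fourier coefficients on `[0, 1]` of the character `t ↦ exp (2πixt)` of non-integral
frequency `x`. -/
theorem fourierCoeffOn_exp_two_pi_I_mul (x : ℝ) (hx : ∀ n : ℤ, x ≠ n) (n : ℤ) :
    fourierCoeffOn (zero_lt_one' ℝ) (fun t : ℝ => Complex.exp (2 * π * Complex.I * x * t)) n =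
      (Complex.exp (Complex.I * (2 * π * x : ℝ)) - 1) / (2 * π * Complex.I * (x - n)) := by
  have hxn : (x - n : ℂ) ≠ 0 := sub_ne_zero.2 (by exact_mod_cast hx n)
  have hc : (2 * π * Complex.I * (x - n) : ℂ) ≠ 0 :=
    mul_ne_zero Complex.two_pi_I_ne_zero hxn
  have hint : ∀ t : ℝ, fourier (-n) (t : AddCircle ((1 : ℝ) - 0)) •
      Complex.exp (2 * π * Complex.I * x * t) =
        Complex.exp (2 * π * Complex.I * (x - n) * t) := by
    intro t
    rw [fourier_coe_apply, smul_eq_mul, ← Complex.exp_add]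
    congr 1
    push_cast
    ring
  have hend : Complex.exp (2 * π * Complex.I * (x - n) * (1 : ℝ)) =
      Complex.exp (Complex.I * (2 * π * x : ℝ)) := by
    rw [Complex.exp_eq_exp_iff_exists_int]
    exact ⟨-n, by push_cast; ring⟩
  rw [fourierCoeffOn_eq_integral]
  simp_rw [hint]
  rw [integral_exp_mul_complex hc, hend]
  simp

/-- The squared modulus of the Fourier coefficients of `t ↦ exp (2πixt)` on `[0, 1]`. -/
theorem norm_sq_fourierCoeffOn_exp_two_pi_I_mul (x : ℝ) (hx : ∀ n : ℤ, x ≠ n) (n : ℤ) :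
    ‖fourierCoeffOn (zero_lt_one' ℝ)
        (fun t : ℝ => Complex.exp (2 * π * Complex.I * x * t)) n‖ ^ 2 =
      Real.sin (π * x) ^ 2 / π ^ 2 * (1 / (x - n) ^ 2) := by
  have hden : ‖(2 * π * Complex.I * (x - n) : ℂ)‖ = 2 * π * |x - n| := by
    rw [← Complex.ofReal_intCast, ← Complex.ofReal_sub]
    simp [abs_of_pos Real.pi_pos, -Complex.ofReal_sub]
  rw [fourierCoeffOn_exp_two_pi_I_mul x hx, norm_div, hden,
    Complex.norm_exp_I_mul_ofReal_sub_one, div_pow, mul_pow, sq_abs, Real.norm_eq_abs, sq_abs,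
    show 2 * π * x / 2 = π * x by ring]
  have := sub_ne_zero.2 (hx n)
  field_simp

theorem inv_sq_sin_series_expansion (x : ℝ) (hx : ∀ n : ℤ, x ≠ n) :
    HasSum (fun n : ℤ => 1 / (x - n) ^ 2)
      (Real.pi ^ 2 / Real.sin (Real.pi * x) ^ 2) := by
  have hsin : Real.sin (π * x) ≠ 0 := by
    rw [Real.sin_ne_zero_iff]
    intro n h
    exact hx n (mul_left_cancel₀ Real.pi_ne_zero (by rw [← h]; ring))
  have hnorm : ∀ t : ℝ, ‖Complex.exp (2 * π * Complex.I * x * t)‖ = 1 := fun t => by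
    rw [show (2 * π * Complex.I * x * t : ℂ) = (2 * π * x * t : ℝ) * Complex.I by
      push_cast; ring]
    exact Complex.norm_exp_ofReal_mul_I _
  have hL2 : MeasureTheory.MemLp (fun t : ℝ => Complex.exp (2 * π * Complex.I * x * t)) 2
      (MeasureTheory.volume.restrict (Set.Ioc 0 1)) :=
    MeasureTheory.MemLp.of_bound (by fun_prop) 1 (.of_forall fun t => (hnorm t).le)
  have hparseval := hasSum_sq_fourierCoeffOn (zero_lt_one' ℝ) hL2
  simp_rw [norm_sq_fourierCoeffOn_exp_two_pi_I_mul x hx, hnorm] at hparseval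
  convert! hparseval.mul_left (π ^ 2 / Real.sin (π * x) ^ 2) using 1
  · ext n
    rw [← mul_assoc, div_mul_div_cancel₀ (pow_ne_zero 2 hsin),
      div_self (pow_ne_zero 2 Real.pi_ne_zero), one_mul]
  · simp
end

section
/- Let k > 0 be real and n ∈ ℕ. The Gegenbauer polynomial function f(x) = G_n^{(k)}(x) satisfies the differential equation (1−x²)·f''(x) − (2k+1)·x·f'(x) + n·(n+2k)·f(x) = 0 for every real x. -/
open Real

/-- The Gegenbauer polynomial `G_n^{(k)}` as a function of a real variable. -/
noncomputable def gegenbauer (k : ℝ) (n : ℕ) (y : ℝ) : ℝ :=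
  (1 / Real.Gamma k) *
    ∑ m ∈ Finset.range (n / 2 + 1),
      (-1 : ℝ) ^ m * Real.Gamma (k + n - m) /
          ((m.factorial : ℝ) * ((n - 2 * m).factorial : ℝ)) * (2 * y) ^ (n - 2 * m)

/-- The coefficient of `(2y)^(n-2m)` in `Γ(k) G_n^{(k)}(y)`. -/
noncomputable def gegenbauerCoeff (k : ℝ) (n m : ℕ) : ℝ :=
  (-1 : ℝ) ^ m * Real.Gamma (k + n - m) / ((m.factorial : ℝ) * ((n - 2 * m).factorial : ℝ))

theorem gegenbauerCoeff_succ (k : ℝ) (hk : 0 < k) (n m : ℕ) (hm : 2 * m + 2 ≤ n) :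
    ((m : ℝ) + 1) * (k + n - (m + 1)) * gegenbauerCoeff k n (m + 1) =
      -(((n - 2 * m : ℕ) : ℝ) * ((n - 2 * m - 1 : ℕ) : ℝ) * gegenbauerCoeff k n m) := by
  obtain ⟨q, rfl⟩ := Nat.exists_eq_add_of_le hm
  have h1 : 2 * m + 2 + q - 2 * m = q + 2 := by omega
  have h2 : 2 * m + 2 + q - 2 * (m + 1) = q := by omega
  have h3 : q + 2 - 1 = q + 1 := by omega
  have hpos : (0 : ℝ) < k + m + q + 1 := by positivity
  have hG := Real.Gamma_add_one hpos.ne'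
  have e1 : k + ((2 * m + 2 + q : ℕ) : ℝ) - m = k + m + q + 1 + 1 := by push_cast; ring
  have e2 : k + ((2 * m + 2 + q : ℕ) : ℝ) - ((m + 1 : ℕ) : ℝ) = k + m + q + 1 := by
    push_cast; ring
  have e3 : k + ((2 * m + 2 + q : ℕ) : ℝ) - ((m : ℝ) + 1) = k + m + q + 1 := by
    push_cast; ring
  unfold gegenbauerCoeff
  rw [e1, e2, e3, h1, h2, h3, hG, Nat.factorial_succ (q + 1), Nat.factorial_succ q,
    Nat.factorial_succ m]
  have hm0 := Nat.cast_ne_zero (R := ℝ).2 m.factorial_ne_zero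
  have hq0 := Nat.cast_ne_zero (R := ℝ).2 q.factorial_ne_zero
  have hm1 : (m : ℝ) + 1 ≠ 0 := by positivity
  have hq1 : (q : ℝ) + 1 ≠ 0 := by positivity
  have hq2 : (q : ℝ) + 1 + 1 ≠ 0 := by positivity
  push_cast
  field_simp
  ring

theorem deriv_const_mul_sum_two_mul_pow (C : ℝ) (s : Finset ℕ) (a : ℕ → ℝ) (e : ℕ → ℕ) :
    deriv (fun y : ℝ => C * ∑ m ∈ s, a m * (2 * y) ^ e m) =
      fun y => C * ∑ m ∈ s, (2 * e m * a m) * (2 * y) ^ (e m - 1) := by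
  ext y
  refine HasDerivAt.deriv (HasDerivAt.const_mul C (HasDerivAt.fun_sum fun m _ => ?_))
  have h := (((hasDerivAt_id' y).const_mul 2).fun_pow (e m)).const_mul (a m)
  exact h.congr_deriv (by ring)

theorem sum_gegenbauerCoeff_eq_zero (k : ℝ) (hk : 0 < k) (n : ℕ) (z : ℝ) :
    ∑ m ∈ Finset.range (n / 2 + 1),
      (((n - 2 * m : ℕ) : ℝ) * ((n - 2 * m - 1 : ℕ) : ℝ) * gegenbauerCoeff k n m *
          z ^ (n - 2 * m - 2) +
        m * (k + n - m) * gegenbauerCoeff k n m * z ^ (n - 2 * m)) = 0 := by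
  have hlast : ((n - 2 * (n / 2) : ℕ) : ℝ) * ((n - 2 * (n / 2) - 1 : ℕ) : ℝ) = 0 := by
    rw [show n - 2 * (n / 2) - 1 = 0 by omega]
    simp
  rw [Finset.sum_add_distrib, Finset.sum_range_succ, Finset.sum_range_succ', hlast]
  simp only [Nat.cast_zero, zero_mul, add_zero]
  rw [← Finset.sum_add_distrib]
  refine Finset.sum_eq_zero fun m hm => ?_
  have hm' : 2 * m + 2 ≤ n := by
    have := Finset.mem_range.1 hm
    omega
  rw [Nat.cast_succ, gegenbauerCoeff_succ k hk n m hm',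
    show n - 2 * (m + 1) = n - 2 * m - 2 by omega]
  ring

theorem gegenbauer_ode (k : ℝ) (hk : 0 < k) (n : ℕ) (x : ℝ) :
    (1 - x ^ 2) * deriv (deriv (gegenbauer k n)) x
        - (2 * k + 1) * x * deriv (gegenbauer k n) x
        + n * (n + 2 * k) * gegenbauer k n x = 0 := by
  have hf : gegenbauer k n = fun y => (1 / Real.Gamma k) *
      ∑ m ∈ Finset.range (n / 2 + 1), gegenbauerCoeff k n m * (2 * y) ^ (n - 2 * m) := rfl
  rw [hf, deriv_const_mul_sum_two_mul_pow _ _ _ fun m => n - 2 * m,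
    deriv_const_mul_sum_two_mul_pow _ _ _ fun m => n - 2 * m - 1]
  have key := congrArg (fun t => 4 * (1 / Real.Gamma k) * t)
    (sum_gegenbauerCoeff_eq_zero k hk n (2 * x))
  simp only [mul_zero] at key
  rw [← key]
  simp only [Finset.mul_sum]
  rw [← Finset.sum_sub_distrib, ← Finset.sum_add_distrib]
  refine Finset.sum_congr rfl fun m hm => ?_
  obtain ⟨p, rfl⟩ : ∃ p, n = 2 * m + p :=
    Nat.exists_eq_add_of_le (by have := Finset.mem_range.1 hm; omega)
  rw [Nat.add_sub_cancel_left]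
  rcases p with _ | _ | q
  · simp
    ring
  · simp
    ring
  · simp only [Nat.add_sub_cancel, show q + 1 + 1 - 2 = q by omega]
    push_cast
    ring
end

section
/- Let k > 1/2 be real and n ∈ ℕ. Then ∫_{−1}^1 G_n^{(k)}(x)·(1−x²)^{k−3/2} dx = Γ(k−1/2)·√π / Γ(k) if n is even, and this integral equals 0 if n is odd. -/
open Real

theorem Real.integral_rpow_mul_one_sub_rpow {a b : ℝ} (ha : 0 < a) (hb : 0 < b) :
    ∫ x in (0:ℝ)..1, x ^ (a - 1) * (1 - x) ^ (b - 1)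
      = Real.Gamma a * Real.Gamma b / Real.Gamma (a + b) := by
  have h := Complex.betaIntegral_eq_Gamma_mul_div (a : ℂ) (b : ℂ) (by simpa) (by simpa)
  rw [← Complex.ofReal_add, Complex.Gamma_ofReal, Complex.Gamma_ofReal, Complex.Gamma_ofReal,
    Complex.betaIntegral] at h
  apply Complex.ofReal_injective
  rw [← intervalIntegral.integral_ofReal]
  push_cast
  rw [← h]
  refine intervalIntegral.integral_congr fun x hx ↦ ?_
  rw [Set.uIcc_of_le zero_le_one] at hx
  simp only [Complex.ofReal_cpow hx.1, Complex.ofReal_cpow (sub_nonneg.2 hx.2)]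
  push_cast
  rfl

theorem intervalIntegral.integral_two_mul_comp_sq (g : ℝ → ℝ) :
    ∫ x in (0:ℝ)..1, 2 * x * g (x ^ 2) = ∫ x in (0:ℝ)..1, g x := by
  have h := MeasureTheory.integral_comp_rpow_Ioi_of_pos (g := (Set.Iic (1:ℝ)).indicator g)
    (zero_lt_two)
  rw [MeasureTheory.setIntegral_indicator measurableSet_Iic, Set.Ioi_inter_Iic] at h
  rw [intervalIntegral.integral_of_le zero_le_one, intervalIntegral.integral_of_le zero_le_one,
    ← h, ← Set.Ioi_inter_Iic, ← MeasureTheory.setIntegral_indicator measurableSet_Iic]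
  refine MeasureTheory.setIntegral_congr_fun measurableSet_Ioi fun x hx ↦ ?_
  have hx : 0 < x := hx
  have hx1 : x ^ 2 ≤ 1 ↔ x ≤ 1 := by rw [sq_le_one_iff₀ hx.le]
  norm_num [Set.indicator, hx1]

theorem intervalIntegrable_one_sub_sq_rpow {c : ℝ} (hc : -1 < c) :
    IntervalIntegrable (fun x : ℝ ↦ (1 - x ^ 2) ^ c) MeasureTheory.volume (-1) 1 := by
  have h : IntervalIntegrable (fun x : ℝ ↦ (1 - x ^ 2) ^ c) MeasureTheory.volume 0 1 := by
    have h0 : IntervalIntegrable (fun x : ℝ ↦ (1 - x) ^ c) MeasureTheory.volume 0 1 := by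
      simpa using ((intervalIntegral.intervalIntegrable_rpow' hc (a := 0) (b := 1)).comp_sub_left
        1).symm
    have h1 : ContinuousOn (fun x : ℝ ↦ (1 + x) ^ c) (Set.uIcc 0 1) := by
      rw [Set.uIcc_of_le zero_le_one]
      exact ContinuousOn.rpow_const (by fun_prop) fun x hx ↦ Or.inl (by linarith [hx.1])
    refine (h0.mul_continuousOn h1).congr fun x hx ↦ ?_
    rw [Set.uIoc_of_le zero_le_one] at hx
    rw [← mul_rpow (by linarith [hx.2]) (by linarith [hx.1])]
    ring_nf
  have h' : IntervalIntegrable (fun x : ℝ ↦ (1 - x ^ 2) ^ c) MeasureTheory.volume (-1) 0 := by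
    simpa using (h.comp_sub_left 0).symm
  exact h'.trans h

theorem intervalIntegrable_pow_mul_one_sub_sq_rpow (n : ℕ) {c : ℝ} (hc : -1 < c) :
    IntervalIntegrable (fun x : ℝ ↦ x ^ n * (1 - x ^ 2) ^ c) MeasureTheory.volume (-1) 1 :=
  (intervalIntegrable_one_sub_sq_rpow hc).continuousOn_mul (by fun_prop)

theorem integral_pow_even_mul_one_sub_sq_rpow (j : ℕ) {c : ℝ} (hc : -1 < c) :
    ∫ x in (-1:ℝ)..1, x ^ (2 * j) * (1 - x ^ 2) ^ c
      = Real.Gamma (j + 1 / 2) * Real.Gamma (c + 1) / Real.Gamma (j + c + 3 / 2) := by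
  have hint := intervalIntegrable_pow_mul_one_sub_sq_rpow (2 * j) hc
  have hneg : ∫ x in (-1:ℝ)..0, x ^ (2 * j) * (1 - x ^ 2) ^ c
      = ∫ x in (0:ℝ)..1, x ^ (2 * j) * (1 - x ^ 2) ^ c := by
    have := intervalIntegral.integral_comp_neg (a := 0) (b := 1)
      (fun x : ℝ ↦ x ^ (2 * j) * (1 - x ^ 2) ^ c)
    simpa [pow_mul] using this.symm
  have h0 : (0:ℝ) ∈ Set.uIcc (-1:ℝ) 1 := by simp [Set.uIcc_of_le]
  rw [← intervalIntegral.integral_add_adjacent_intervals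
    (hint.mono_set (Set.uIcc_subset_uIcc_left h0)) (hint.mono_set (Set.uIcc_subset_uIcc_right h0)),
    hneg, ← two_mul]
  have hbeta := Real.integral_rpow_mul_one_sub_rpow (a := j + 1 / 2) (b := c + 1)
    (by positivity) (by linarith)
  rw [← intervalIntegral.integral_two_mul_comp_sq,
    show (j:ℝ) + 1 / 2 + (c + 1) = j + c + 3 / 2 by ring] at hbeta
  rw [← hbeta, ← intervalIntegral.integral_const_mul]
  rw [intervalIntegral.integral_of_le zero_le_one, intervalIntegral.integral_of_le zero_le_one]
  refine MeasureTheory.setIntegral_congr_fun measurableSet_Ioc fun x hx ↦ ?_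
  have hx0 : 0 < x := hx.1
  have : x ^ (2 * j) = x * (x ^ 2) ^ ((j:ℝ) + 1 / 2 - 1) := by
    rw [← Real.rpow_natCast x 2, ← rpow_mul hx0.le]
    nth_rw 2 [← rpow_one x]
    rw [← rpow_add hx0, ← Real.rpow_natCast]
    push_cast
    ring_nf
  simp only [this]
  ring_nf

theorem integral_pow_odd_mul_one_sub_sq_rpow {n : ℕ} (hn : Odd n) (c : ℝ) :
    ∫ x in (-1:ℝ)..1, x ^ n * (1 - x ^ 2) ^ c = 0 := by
  have := intervalIntegral.integral_comp_neg (a := -1) (b := 1)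
    (fun x : ℝ ↦ x ^ n * (1 - x ^ 2) ^ c)
  simp only [hn.neg_pow, even_two, Even.neg_pow, neg_mul, intervalIntegral.integral_neg,
    neg_neg] at this
  linarith

theorem Real.Gamma_nat_add_half_eq_factorial (j : ℕ) :
    Real.Gamma (j + 1 / 2) = (2 * j).factorial * √π / (4 ^ j * j.factorial) := by
  induction j with
  | zero => simp [-one_div, Real.Gamma_one_half_eq]
  | succ j ih =>
    rw [show ((j + 1 : ℕ) : ℝ) + 1 / 2 = (j + 1 / 2) + 1 by push_cast; ring,
      Real.Gamma_add_one (by positivity), ih, show 2 * (j + 1) = 2 * j + 1 + 1 by ring,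
      Nat.factorial_succ, Nat.factorial_succ, Nat.factorial_succ]
    push_cast
    field_simp
    ring

theorem Real.Gamma_add_nat_eq_mul_ascPochhammer {x : ℝ} (hx : 0 < x) (n : ℕ) :
    Real.Gamma (x + n) = Real.Gamma x * (ascPochhammer ℝ n).eval x := by
  induction n with
  | zero => simp
  | succ n ih =>
    rw [ascPochhammer_succ_eval, ← mul_assoc, ← ih, Nat.cast_succ, ← add_assoc,
      Real.Gamma_add_one (by positivity), mul_comm]

theorem sum_neg_one_pow_mul_choose_mul_ascPochhammer (N : ℕ) (x : ℝ) :
    ∑ m ∈ Finset.range (N + 1),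
      (-1 : ℝ) ^ m * N.choose m * (ascPochhammer ℝ N).eval (x + (N - m : ℕ)) = N.factorial := by
  have h := congrFun (ascPochhammer ℝ N).fwdDiff_iter_degree_eq_factorial x
  rw [ascPochhammer_natDegree, (monic_ascPochhammer ℝ N).leadingCoeff,
    fwdDiff_iter_eq_sum_shift, ← Finset.sum_range_reflect] at h
  simp only [one_smul, Pi.natCast_apply] at h
  rw [← h]
  refine Finset.sum_congr rfl fun m hm ↦ ?_
  have hm : m ≤ N := Finset.mem_range_succ_iff.1 hm
  rw [Nat.add_sub_cancel, Nat.sub_sub_self hm, Nat.choose_symm hm]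
  simp

theorem integral_gegenbauer_weight (k : ℝ) (hk : 1 / 2 < k) (n : ℕ) :
    ∫ x in (-1:ℝ)..1, gegenbauer k n x * (1 - x ^ 2) ^ (k - 3 / 2)
      = if Even n then Real.Gamma (k - 1 / 2) * Real.sqrt Real.pi / Real.Gamma k
        else 0 := by
  have hc : -1 < k - 3 / 2 := by linarith
  have hexp : ∀ x : ℝ, gegenbauer k n x * (1 - x ^ 2) ^ (k - 3 / 2)
      = ∑ m ∈ Finset.range (n / 2 + 1),
        (1 / Real.Gamma k * ((-1 : ℝ) ^ m * Real.Gamma (k + n - m) /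
          ((m.factorial : ℝ) * ((n - 2 * m).factorial : ℝ)) * 2 ^ (n - 2 * m))) *
          (x ^ (n - 2 * m) * (1 - x ^ 2) ^ (k - 3 / 2)) := by
    intro x
    rw [gegenbauer, Finset.mul_sum, Finset.sum_mul]
    refine Finset.sum_congr rfl fun m _ ↦ ?_
    rw [mul_pow]
    ring
  simp only [hexp]
  rw [intervalIntegral.integral_finsetSum fun m _ ↦
    (intervalIntegrable_pow_mul_one_sub_sq_rpow _ hc).const_mul _]
  simp only [intervalIntegral.integral_const_mul]
  split_ifs with hn
  · obtain ⟨N, rfl⟩ := hn.two_dvd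
    have hsum := sum_neg_one_pow_mul_choose_mul_ascPochhammer N k
    rw [← div_eq_one_iff_eq (by positivity), Finset.sum_div] at hsum
    rw [Nat.mul_div_cancel_left N two_pos]
    refine Eq.trans ?_ (congrArg (Real.Gamma (k - 1 / 2) * √π / Real.Gamma k * ·) hsum |>.trans
      (mul_one _))
    rw [Finset.mul_sum]
    refine Finset.sum_congr rfl fun m hm ↦ ?_
    obtain ⟨j, rfl⟩ := Nat.exists_eq_add_of_le (Finset.mem_range_succ_iff.1 hm)
    have hkj : 0 < k + j := by positivity
    have hG := Real.Gamma_add_nat_eq_mul_ascPochhammer hkj (m + j)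
    have hchoose : (((m + j).choose m : ℕ) : ℝ) * m.factorial * j.factorial
        = (m + j).factorial := by
      have h := Nat.choose_mul_factorial_mul_factorial (Nat.le_add_right m j)
      rw [Nat.add_sub_cancel_left] at h
      exact_mod_cast h
    have hk0 : 0 < k := by linarith
    have hGk := Real.Gamma_pos_of_pos hk0
    have hGkj := Real.Gamma_pos_of_pos hkj
    rw [show 2 * (m + j) - 2 * m = 2 * j by omega, Nat.add_sub_cancel_left,
      integral_pow_even_mul_one_sub_sq_rpow j hc, Real.Gamma_nat_add_half_eq_factorial,
      show k + ((2 * (m + j) : ℕ) : ℝ) - m = k + j + (m + j : ℕ) by push_cast; ring, hG,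
      show (j : ℝ) + (k - 3 / 2) + 3 / 2 = k + j by ring,
      show k - 3 / 2 + 1 = k - 1 / 2 by ring, ← hchoose, pow_mul]
    have hc0 : (0 : ℝ) < (m + j).choose m := by
      exact_mod_cast Nat.choose_pos (Nat.le_add_right m j)
    norm_num only
    field_simp
  · refine Finset.sum_eq_zero fun m hm ↦ ?_
    have hm : m < n / 2 + 1 := Finset.mem_range.1 hm
    have hn : Odd (n - 2 * m) := by
      rw [Nat.odd_sub (by omega)]
      simp [Nat.not_even_iff_odd.1 hn]
    rw [integral_pow_odd_mul_one_sub_sq_rpow hn, mul_zero]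
end

section
/- Let k > 0 be real and define ω_n^{(k)} = n!·(k+n)·Γ(k)² / (2^{1−2k}·Γ(n+2k)) for n ∈ ℕ. Then ω_n^{(k)}·n^{2k−2} converges to 2^{2k−1}·Γ(k)² as n → ∞; in particular ω_n^{(k)} is asymptotically equivalent to a constant multiple of n^{2−2k}. -/
open Real Filter

theorem Real.Gamma_add_nat_eq_mul_prod {s : ℝ} (hs : 0 < s) (n : ℕ) :
    Real.Gamma (n + s) = Real.Gamma s * ∏ j ∈ Finset.range n, (s + j) := by
  induction n with
  | zero => simp
  | succ n ih =>
    have h : (n : ℝ) + s ≠ 0 := by positivity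
    rw [Finset.prod_range_succ, ← mul_assoc, ← ih,
      show ((n + 1 : ℕ) : ℝ) + s = (n + s) + 1 by push_cast; ring, Real.Gamma_add_one h]
    ring

theorem tendsto_const_add_natCast_div_natCast (a : ℝ) :
    Tendsto (fun n : ℕ => (a + n) / (n : ℝ)) atTop (nhds 1) := by
  have h := (tendsto_const_div_atTop_nhds_zero_nat a).add_const 1
  rw [zero_add] at h
  refine h.congr' ?_
  filter_upwards [eventually_ne_atTop 0] with n hn
  field_simp

theorem omega_asymptotic (k : ℝ) (hk : 0 < k) :
    Tendsto
      (fun n : ℕ =>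
        ((n.factorial : ℝ) * (k + n) * Real.Gamma k ^ 2 /
            ((2 : ℝ) ^ (1 - 2 * k) * Real.Gamma (n + 2 * k))) * (n : ℝ) ^ (2 * k - 2))
      atTop (nhds ((2 : ℝ) ^ (2 * k - 1) * Real.Gamma k ^ 2)) := by
  have hs : 0 < 2 * k := by positivity
  have hG : Real.Gamma (2 * k) ≠ 0 := (Real.Gamma_pos_of_pos hs).ne'
  have key := ((((Real.GammaSeq_tendsto_Gamma (2 * k)).div_const (Real.Gamma (2 * k))).mul
    (tendsto_const_add_natCast_div_natCast (2 * k))).mul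
    (tendsto_const_add_natCast_div_natCast k)).mul_const
      ((2 : ℝ) ^ (2 * k - 1) * Real.Gamma k ^ 2)
  rw [div_self hG, one_mul, one_mul, one_mul] at key
  refine key.congr' ?_
  filter_upwards [eventually_gt_atTop 0] with n hn
  have hn' : (0 : ℝ) < n := by exact_mod_cast hn
  have hP : ∏ j ∈ Finset.range n, (2 * k + (j : ℝ)) ≠ 0 :=
    Finset.prod_ne_zero_iff.2 fun j _ => by positivity
  have h2 : (2 : ℝ) ^ (1 - 2 * k) ≠ 0 := by positivity
  have hkn : 2 * k + (n : ℝ) ≠ 0 := by positivity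
  rw [Real.GammaSeq, Finset.prod_range_succ, Real.Gamma_add_nat_eq_mul_prod hs,
    Real.rpow_sub hn', Real.rpow_two, show 2 * k - 1 = -(1 - 2 * k) by ring,
    Real.rpow_neg zero_le_two]
  generalize (2 : ℝ) ^ (1 - 2 * k) = c at *
  generalize ∏ j ∈ Finset.range n, (2 * k + (j : ℝ)) = P at *
  generalize (n : ℝ) ^ (2 * k) = N at *
  field_simp
end

section
/- Let k > 1/2 be real and x ∈ (0,1). Then the series ∑_{n=1}^∞ (ω_{2n}^{(k)}/λ_{2n}) · |G_{2n}^{(k)}(cos(πx))| converges, where λ_m = (π²/2)·m·(m+2k) and ω_m^{(k)} = m!·(k+m)·Γ(k)² / (2^{1−2k}·Γ(m+2k)). -/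
open Real

/-- The eigenvalue `λ_n = (π²/2) n (n + 2k)`. -/
noncomputable def lambdaAff (k : ℝ) (n : ℕ) : ℝ :=
  Real.pi ^ 2 / 2 * n * (n + 2 * k)

/-- The normalization constant `ω_n^{(k)}`. -/
noncomputable def omegaAff (k : ℝ) (n : ℕ) : ℝ :=
  (n.factorial : ℝ) * (k + n) * Real.Gamma k ^ 2 /
    ((2 : ℝ) ^ (1 - 2 * k) * Real.Gamma (n + 2 * k))

open Polynomial in
/-- A polynomial solution of the Gegenbauer equation which is flat at `0` is controlled on `(-1, 1)`
by its value at `0`, through the monotonicity of the weighted energy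
`(1 - t²)^(2k) (μ P² + (1 - t²) P'²)`. -/
theorem abs_eval_mul_rpow_le_of_gegenbauer_ode {k μ : ℝ} (hk : 0 < k) (hμ : 0 < μ) (P : ℝ[X])
    (hP0 : P.derivative.eval 0 = 0)
    (hP : ∀ t, (1 - t ^ 2) * P.derivative.derivative.eval t
      = (2 * k + 1) * t * P.derivative.eval t - μ * P.eval t)
    {y : ℝ} (hy0 : 0 ≤ y) (hy1 : y < 1) :
    |P.eval y| * (1 - y ^ 2) ^ k ≤ |P.eval 0| := by
  have hpos : ∀ t ∈ Set.Icc 0 y, 0 < 1 - t ^ 2 := fun t ht => by nlinarith [ht.1, ht.2]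
  set F : ℝ → ℝ := fun t => (1 - t ^ 2) ^ (2 * k) *
    (μ * P.eval t ^ 2 + (1 - t ^ 2) * P.derivative.eval t ^ 2) with hF
  have hderiv : ∀ t ∈ Set.Icc 0 y, HasDerivAt F
      (-((1 - t ^ 2) ^ (2 * k - 1) * (4 * k * t * μ * P.eval t ^ 2))) t := by
    intro t ht
    have hw : HasDerivAt (fun t : ℝ => 1 - t ^ 2) (-(2 * t)) t := by
      simpa using (hasDerivAt_pow 2 t).const_sub 1
    have h := (hw.rpow_const (p := 2 * k) (Or.inl (hpos t ht).ne')).mul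
      ((((P.hasDerivAt t).pow 2).const_mul μ).add (hw.mul ((P.derivative.hasDerivAt t).pow 2)))
    refine h.congr_deriv ?_
    have hsplit : (1 - t ^ 2) ^ (2 * k) = (1 - t ^ 2) ^ (2 * k - 1) * (1 - t ^ 2) := by
      rw [← Real.rpow_add_one (hpos t ht).ne', sub_add_cancel]
    simp only [Pi.add_apply, Pi.mul_apply, Pi.pow_apply, hsplit]
    push_cast
    linear_combination
      2 * (1 - t ^ 2) ^ (2 * k - 1) * (1 - t ^ 2) * P.derivative.eval t * hP t
  have hanti : AntitoneOn F (Set.Icc 0 y) := by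
    refine antitoneOn_of_hasDerivWithinAt_nonpos (convex_Icc 0 y)
      (fun t ht => (hderiv t ht).continuousAt.continuousWithinAt)
      (fun t ht => (hderiv t (interior_subset ht)).hasDerivWithinAt) fun t ht => ?_
    have ht' := interior_subset ht
    have := Real.rpow_nonneg (hpos t ht').le (2 * k - 1)
    have := ht'.1
    exact neg_nonpos.2 (by positivity)
  have hle := hanti (Set.left_mem_Icc.2 hy0) (Set.right_mem_Icc.2 hy0) hy0
  have hyp := hpos y (Set.right_mem_Icc.2 hy0)
  have hsq : (1 - y ^ 2) ^ (2 * k) = ((1 - y ^ 2) ^ k) ^ 2 := by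
    rw [mul_comm, Real.rpow_mul hyp.le, Real.rpow_two]
  simp only [hF, hP0, hsq] at hle
  norm_num at hle
  have hrest : 0 ≤ ((1 - y ^ 2) ^ k) ^ 2 * ((1 - y ^ 2) * P.derivative.eval y ^ 2) := by positivity
  refine abs_le_of_sq_le_sq' ?_ (abs_nonneg _) |>.2
  rw [mul_pow, sq_abs, sq_abs]
  refine le_of_mul_le_mul_left ?_ hμ
  linarith

/-- The coefficient of `y ^ (2 * j)` in `gegenbauer k (2 * N) y`. -/
noncomputable def gegenbauerEvenCoeff (k : ℝ) (N j : ℕ) : ℝ :=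
  1 / Real.Gamma k * ((-1) ^ (N - j) * Real.Gamma (k + N + j) /
    (((N - j).factorial : ℝ) * ((2 * j).factorial : ℝ)) * 4 ^ j)

open Polynomial in
/-- The Gegenbauer polynomial of degree `2 * N`, as an element of `ℝ[X]`. -/
noncomputable def gegenbauerEvenPoly (k : ℝ) (N : ℕ) : ℝ[X] :=
  ∑ j ∈ Finset.range (N + 1), C (gegenbauerEvenCoeff k N j) * X ^ (2 * j)

theorem eval_gegenbauerEvenPoly (k : ℝ) (N : ℕ) (y : ℝ) :
    (gegenbauerEvenPoly k N).eval y =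
      ∑ j ∈ Finset.range (N + 1), gegenbauerEvenCoeff k N j * y ^ (2 * j) := by
  simp [gegenbauerEvenPoly, Polynomial.eval_finsetSum]

theorem gegenbauer_two_mul (k : ℝ) (N : ℕ) (y : ℝ) :
    gegenbauer k (2 * N) y = (gegenbauerEvenPoly k N).eval y := by
  rw [eval_gegenbauerEvenPoly, gegenbauer, Nat.mul_div_cancel_left _ two_pos, Finset.mul_sum,
    ← Finset.sum_range_reflect]
  refine Finset.sum_congr rfl fun j hj => ?_
  have hjN : j ≤ N := Nat.lt_succ_iff.1 (Finset.mem_range.1 hj)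
  have h1 : N + 1 - 1 - j = N - j := by omega
  have h2 : 2 * N - 2 * (N - j) = 2 * j := by omega
  have h3 : k + ((2 * N : ℕ) : ℝ) - ((N - j : ℕ) : ℝ) = k + N + j := by
    push_cast [Nat.cast_sub hjN]
    ring
  rw [h1, h2, h3, gegenbauerEvenCoeff, mul_pow, pow_mul 2]
  norm_num
  ring

theorem gegenbauerEvenCoeff_succ {k : ℝ} (hk : 0 < k) {N j : ℕ} (hj : j < N) :
    (2 * j + 2) * (2 * j + 1) * gegenbauerEvenCoeff k N (j + 1) =
      -(4 * (N - j) * (N + j + k) * gegenbauerEvenCoeff k N j) := by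
  obtain ⟨d, rfl⟩ := Nat.exists_eq_add_of_lt hj
  have h1 : j + d + 1 - (j + 1) = d := by omega
  have h2 : j + d + 1 - j = d + 1 := by omega
  have h3 : Real.Gamma (k + ((j + d + 1 : ℕ) : ℝ) + ((j + 1 : ℕ) : ℝ)) =
      (k + ((j + d + 1 : ℕ) : ℝ) + j) * Real.Gamma (k + ((j + d + 1 : ℕ) : ℝ) + j) := by
    rw [← Real.Gamma_add_one (by positivity)]
    push_cast
    ring_nf
  have hΓ := (Real.Gamma_pos_of_pos hk).ne'
  rw [gegenbauerEvenCoeff, gegenbauerEvenCoeff, h1, h2, h3, Nat.mul_succ, Nat.factorial_succ,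
    Nat.factorial_succ, Nat.factorial_succ]
  push_cast
  have := Nat.cast_ne_zero (R := ℝ).2 (Nat.factorial_ne_zero d)
  have := Nat.cast_ne_zero (R := ℝ).2 (Nat.factorial_ne_zero (2 * j))
  have : (2 * (j : ℝ) + 1 + 1) ≠ 0 := by positivity
  have : (2 * (j : ℝ) + 1) ≠ 0 := by positivity
  have : ((d : ℝ) + 1) ≠ 0 := by positivity
  field_simp
  ring

theorem gegenbauerEvenPoly_ode {k : ℝ} (hk : 0 < k) (N : ℕ) (t : ℝ) :
    (1 - t ^ 2) * (gegenbauerEvenPoly k N).derivative.derivative.eval t =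
      (2 * k + 1) * t * (gegenbauerEvenPoly k N).derivative.eval t -
        4 * N * (N + k) * (gegenbauerEvenPoly k N).eval t := by
  set c := gegenbauerEvenCoeff k N with hc
  set D : ℕ → ℝ := fun j => 2 * j * (2 * j - 1) * c j * t ^ (2 * j - 2) with hD
  have hterm : ∀ j : ℕ, (1 - t ^ 2) * (c j * (2 * j * (2 * j - 1) * t ^ (2 * j - 2))) -
      (2 * k + 1) * t * (c j * (2 * j * t ^ (2 * j - 1))) + 4 * N * (N + k) * (c j * t ^ (2 * j)) =
      D j + 4 * (N - j) * (N + j + k) * c j * t ^ (2 * j) := by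
    rintro (_ | j)
    · simp [hD]
    · have h1 : 2 * (j + 1) - 2 = 2 * j := by omega
      have h2 : 2 * (j + 1) - 1 = 2 * j + 1 := by omega
      simp only [hD, h1, h2]
      push_cast
      ring
  have hsum : ∀ M ≤ N, ∑ j ∈ Finset.range M,
      (D j + 4 * (N - j) * (N + j + k) * c j * t ^ (2 * j)) = -D M := by
    intro M
    induction M with
    | zero => simp [hD]
    | succ M ih =>
      intro hM
      have h1 : 2 * (M + 1) - 2 = 2 * M := by omega
      rw [Finset.sum_range_succ, ih (by omega)]
      have hr := gegenbauerEvenCoeff_succ hk (show M < N by omega)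
      simp only [hD, h1]
      push_cast
      linear_combination t ^ (2 * M) * hr
  have hfull : ∑ j ∈ Finset.range (N + 1),
      (D j + 4 * (N - j) * (N + j + k) * c j * t ^ (2 * j)) = 0 := by
    rw [Finset.sum_range_succ, hsum N le_rfl]
    ring
  have hd1 : (gegenbauerEvenPoly k N).derivative.eval t =
      ∑ j ∈ Finset.range (N + 1), c j * (2 * j * t ^ (2 * j - 1)) := by
    simp [gegenbauerEvenPoly, Polynomial.eval_finsetSum, Polynomial.derivative_X_pow, hc]
  have hd2 : (gegenbauerEvenPoly k N).derivative.derivative.eval t =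
      ∑ j ∈ Finset.range (N + 1), c j * (2 * j * (2 * j - 1) * t ^ (2 * j - 2)) := by
    simp only [gegenbauerEvenPoly, Polynomial.derivative_sum, Polynomial.eval_finsetSum]
    refine Finset.sum_congr rfl fun j _ => ?_
    rcases j with _ | j
    · simp
    · have h1 : 2 * (j + 1) - 2 = 2 * j := by omega
      have h2 : 2 * (j + 1) - 1 = 2 * j + 1 := by omega
      simp [h1, h2, hc, Polynomial.derivative_X_pow]
      left
      ring
  rw [hd1, hd2, eval_gegenbauerEvenPoly, ← sub_eq_zero, ← hfull, Finset.mul_sum, Finset.mul_sum,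
    Finset.mul_sum, sub_sub_eq_add_sub, ← Finset.sum_add_distrib, ← Finset.sum_sub_distrib]
  refine Finset.sum_congr rfl fun j _ => ?_
  rw [← hterm]
  ring

theorem eval_zero_derivative_gegenbauerEvenPoly (k : ℝ) (N : ℕ) :
    (gegenbauerEvenPoly k N).derivative.eval 0 = 0 := by
  simp only [gegenbauerEvenPoly, Polynomial.derivative_sum, Polynomial.eval_finsetSum]
  refine Finset.sum_eq_zero fun j _ => ?_
  rcases j with _ | j
  · simp
  · simp [show 2 * (j + 1) - 1 = 2 * j + 1 by omega, Polynomial.derivative_X_pow]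

theorem eval_zero_gegenbauerEvenPoly (k : ℝ) (N : ℕ) :
    (gegenbauerEvenPoly k N).eval 0 =
      1 / Real.Gamma k * ((-1) ^ N * Real.Gamma (k + N) / (N.factorial : ℝ)) := by
  rw [eval_gegenbauerEvenPoly, Finset.sum_eq_single 0]
  · simp [gegenbauerEvenCoeff]
  · intro j _ hj
    simp [hj]
  · simp

theorem abs_gegenbauer_two_mul_le {k : ℝ} (hk : 0 < k) {N : ℕ} (hN : 0 < N) {y : ℝ}
    (hy : |y| < 1) :
    |gegenbauer k (2 * N) y| ≤
      ((1 - y ^ 2) ^ k)⁻¹ * (Real.Gamma (k + N) / (Real.Gamma k * N.factorial)) := by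
  have hN' : (0 : ℝ) < N := Nat.cast_pos.2 hN
  have hbound := abs_eval_mul_rpow_le_of_gegenbauer_ode hk
    (show (0 : ℝ) < 4 * N * (N + k) by positivity) (gegenbauerEvenPoly k N)
    (eval_zero_derivative_gegenbauerEvenPoly k N) (gegenbauerEvenPoly_ode hk N) (abs_nonneg y) hy
  have heven : (gegenbauerEvenPoly k N).eval |y| = gegenbauer k (2 * N) y := by
    simp only [gegenbauer_two_mul, eval_gegenbauerEvenPoly, pow_mul, sq_abs]
  have hpos : 0 < (1 - y ^ 2) ^ k :=
    Real.rpow_pos_of_pos (sub_pos.2 ((sq_lt_one_iff_abs_lt_one y).2 hy)) k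
  have hΓ := Real.Gamma_pos_of_pos hk
  have hΓN := Real.Gamma_pos_of_pos (show 0 < k + N by positivity)
  rw [heven, sq_abs, eval_zero_gegenbauerEvenPoly] at hbound
  simp only [abs_mul, abs_div, abs_pow, abs_neg, abs_one, one_pow, one_mul, abs_of_pos hΓ,
    abs_of_pos hΓN, Nat.abs_cast] at hbound
  rw [inv_mul_eq_div, le_div_iff₀ hpos]
  refine hbound.trans_eq ?_
  field_simp

/-- The ratio `(2m)! Γ(k + m) / (Γ(2m + 2k) m!)`. -/
noncomputable def gammaRatio (k : ℝ) (m : ℕ) : ℝ :=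
  ((2 * m).factorial : ℝ) * Real.Gamma (k + m) /
    (Real.Gamma (2 * m + 2 * k) * (m.factorial : ℝ))

theorem gammaRatio_pos {k : ℝ} (hk : 0 < k) (m : ℕ) : 0 < gammaRatio k m := by
  have := Real.Gamma_pos_of_pos (show 0 < k + m by positivity)
  have := Real.Gamma_pos_of_pos (show 0 < 2 * (m : ℝ) + 2 * k by positivity)
  unfold gammaRatio
  positivity

theorem gammaRatio_succ {k : ℝ} (hk : 0 < k) (m : ℕ) :
    gammaRatio k (m + 1) = (2 * m + 1) / (2 * m + 2 * k + 1) * gammaRatio k m := by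
  have hΓ1 := (Real.Gamma_pos_of_pos (show 0 < k + m by positivity)).ne'
  have hΓ2 := (Real.Gamma_pos_of_pos (show 0 < 2 * (m : ℝ) + 2 * k by positivity)).ne'
  have h1 : Real.Gamma (k + (m + 1 : ℕ)) = (k + m) * Real.Gamma (k + m) := by
    rw [← Real.Gamma_add_one (by positivity)]
    push_cast
    ring_nf
  have h2 : Real.Gamma (2 * (m + 1 : ℕ) + 2 * k) =
      (2 * m + 2 * k + 1) * ((2 * m + 2 * k) * Real.Gamma (2 * m + 2 * k)) := by
    rw [← Real.Gamma_add_one (by positivity), ← Real.Gamma_add_one (by positivity)]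
    push_cast
    ring_nf
  rw [gammaRatio, gammaRatio, h1, h2, Nat.mul_succ, Nat.factorial_succ, Nat.factorial_succ,
    Nat.factorial_succ]
  push_cast
  have := Nat.cast_ne_zero (R := ℝ).2 (Nat.factorial_ne_zero m)
  have : (2 * (m : ℝ) + 2 * k + 1) ≠ 0 := by positivity
  have : (2 * (m : ℝ) + 2 * k) ≠ 0 := by positivity
  have : (m : ℝ) + k ≠ 0 := by positivity
  have : (m : ℝ) + 1 ≠ 0 := by positivity
  field_simp
  ring

theorem summable_gammaRatio_div {k : ℝ} (hk : 0 < k) :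
    Summable fun m : ℕ => gammaRatio k m / (2 * m + 2 * k + 1) := by
  have hdiff : ∀ m : ℕ, gammaRatio k m / (2 * m + 2 * k + 1) =
      1 / (2 * k) * (gammaRatio k m - gammaRatio k (m + 1)) := by
    intro m
    have : (2 * (m : ℝ) + 2 * k + 1) ≠ 0 := by positivity
    rw [gammaRatio_succ hk]
    field_simp
    ring
  refine summable_of_sum_range_le (c := 1 / (2 * k) * gammaRatio k 0)
    (fun m => div_nonneg (gammaRatio_pos hk m).le (by positivity)) fun n => ?_
  rw [Finset.sum_congr rfl fun m _ => hdiff m, ← Finset.mul_sum, Finset.sum_range_sub']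
  have := (gammaRatio_pos hk n).le
  gcongr
  linarith

theorem lambdaAff_pos {k : ℝ} (hk : 0 < k) {n : ℕ} (hn : 0 < n) : 0 < lambdaAff k n := by
  have : (0 : ℝ) < n := Nat.cast_pos.2 hn
  unfold lambdaAff
  positivity

theorem omegaAff_pos {k : ℝ} (hk : 0 < k) (n : ℕ) : 0 < omegaAff k n := by
  have := Real.Gamma_pos_of_pos (show 0 < n + 2 * k by positivity)
  have := Real.Gamma_pos_of_pos hk
  unfold omegaAff
  positivity

theorem omegaAff_div_lambdaAff_mul_le {k : ℝ} (hk : 0 < k) {m : ℕ} (hm : 0 < m) :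
    omegaAff k (2 * m) / lambdaAff k (2 * m) *
        (Real.Gamma (k + m) / (Real.Gamma k * m.factorial)) ≤
      2 * Real.Gamma k * (k + 2) / ((2 : ℝ) ^ (1 - 2 * k) * Real.pi ^ 2) *
        (gammaRatio k m / (2 * m + 2 * k + 1)) := by
  have hm' : (1 : ℝ) ≤ m := Nat.one_le_cast.2 hm
  have hΓ := Real.Gamma_pos_of_pos hk
  have hΓ2 := Real.Gamma_pos_of_pos (show 0 < 2 * (m : ℝ) + 2 * k by positivity)
  have hw : (0 : ℝ) < 2 ^ (1 - 2 * k) := by positivity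
  have heq : omegaAff k (2 * m) / lambdaAff k (2 * m) *
        (Real.Gamma (k + m) / (Real.Gamma k * m.factorial)) =
      2 * Real.Gamma k / ((2 : ℝ) ^ (1 - 2 * k) * Real.pi ^ 2) * gammaRatio k m *
        ((k + 2 * m) / (2 * m * (2 * m + 2 * k))) := by
    unfold omegaAff lambdaAff gammaRatio
    push_cast
    field_simp
  have hfrac : (k + 2 * m) / (2 * m * (2 * m + 2 * k)) ≤ (k + 2) / (2 * m + 2 * k + 1) := by
    rw [div_le_div_iff₀ (by positivity) (by positivity)]
    have h1 : 2 * (m : ℝ) + 2 * k + 1 ≤ 2 * m * (k + 2) := by nlinarith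
    calc (k + 2 * m) * (2 * m + 2 * k + 1) ≤ (2 * m + 2 * k) * (2 * m * (k + 2)) := by
          gcongr ?_ * ?_
          linarith
      _ = (k + 2) * (2 * m * (2 * m + 2 * k)) := by ring
  rw [heq]
  have := gammaRatio_pos hk m
  calc _ ≤ 2 * Real.Gamma k / ((2 : ℝ) ^ (1 - 2 * k) * Real.pi ^ 2) * gammaRatio k m *
        ((k + 2) / (2 * m + 2 * k + 1)) := by gcongr
    _ = _ := by ring

theorem abs_cos_pi_mul_lt_one {x : ℝ} (hx : x ∈ Set.Ioo (0 : ℝ) 1) :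
    |Real.cos (Real.pi * x)| < 1 := by
  have hsin : 0 < Real.sin (Real.pi * x) :=
    Real.sin_pos_of_pos_of_lt_pi (mul_pos Real.pi_pos hx.1)
      (mul_lt_of_lt_one_right Real.pi_pos hx.2)
  rw [← sq_lt_one_iff_abs_lt_one]
  nlinarith [Real.sin_sq_add_cos_sq (Real.pi * x)]

theorem summable_even_gegenbauer_series (k : ℝ) (hk : 1 / 2 < k)
    (x : ℝ) (hx : x ∈ Set.Ioo (0 : ℝ) 1) :
    Summable (fun n : ℕ =>
      omegaAff k (2 * (n + 1)) / lambdaAff k (2 * (n + 1)) *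
        |gegenbauer k (2 * (n + 1)) (Real.cos (Real.pi * x))|) := by
  have hk0 : 0 < k := by linarith
  have hcoef : ∀ n : ℕ, 0 ≤ omegaAff k (2 * (n + 1)) / lambdaAff k (2 * (n + 1)) := fun n =>
    (div_pos (omegaAff_pos hk0 _) (lambdaAff_pos hk0 (by positivity))).le
  have hy := abs_cos_pi_mul_lt_one hx
  set y := Real.cos (Real.pi * x)
  have hA : 0 ≤ ((1 - y ^ 2) ^ k)⁻¹ :=
    inv_nonneg.2 (Real.rpow_nonneg (sub_pos.2 ((sq_lt_one_iff_abs_lt_one y).2 hy)).le k)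
  refine Summable.of_nonneg_of_le (fun n => mul_nonneg (hcoef n) (abs_nonneg _)) (fun n => ?_)
    ((((summable_nat_add_iff 1).2 (summable_gammaRatio_div hk0)).mul_left
      (2 * Real.Gamma k * (k + 2) / ((2 : ℝ) ^ (1 - 2 * k) * Real.pi ^ 2))).mul_left
      ((1 - y ^ 2) ^ k)⁻¹)
  calc _ ≤ _ := mul_le_mul_of_nonneg_left
        (abs_gegenbauer_two_mul_le hk0 n.succ_pos hy) (hcoef n)
    _ = _ := mul_left_comm _ _ _
    _ ≤ _ := mul_le_mul_of_nonneg_left (omegaAff_div_lambdaAff_mul_le hk0 n.succ_pos) hA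
end
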